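/- arXiv:1502.01870 — 3 statements merged into one kernel-verified Lean document; each statement's English description precedes it below -/
import Mathlib

section
/- Let n = 1, so all matrices are 2×2. Let K be a real 2×2 matrix and α a real symmetric positive semidefinite 2×2 matrix. Then the pair (K,α) satisfies the positivity condition if and only if √(det α) ≥ 1 − |det K|. -/
open Matrix Complex
open scoped ComplexOrder

/-- The standard symplectic form for one mode. -/
noncomputable def Δ₂ : Matrix (Fin 2) (Fin 2) ℝ := !![0, 1; -1, 0]

/-- The one-mode transposition `diag(1,-1)`. -/
noncomputable def T₂ : Matrix (Fin 2) (Fin 2) ℝ := !![1, 0; 0, -1]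

/-- `σ ≥ ± iΔ` : both `σ + iΔ` and `σ - iΔ` (as complex matrices) are PSD. -/
noncomputable def GeqPMiDelta (σ : Matrix (Fin 2) (Fin 2) ℝ) : Prop :=
  (σ.map (Complex.ofReal) + Complex.I • Δ₂.map (Complex.ofReal)).PosSemidef ∧
  (σ.map (Complex.ofReal) - Complex.I • Δ₂.map (Complex.ofReal)).PosSemidef

/-- A quantum covariance matrix: real symmetric with `σ ≥ ± iΔ`. -/
noncomputable def IsQCM (σ : Matrix (Fin 2) (Fin 2) ℝ) : Prop :=
  σ.IsSymm ∧ GeqPMiDelta σ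

/-- The positivity condition: `K σ Kᵀ + α ≥ ± iΔ` for every quantum covariance matrix `σ`. -/
noncomputable def PosCond (K α : Matrix (Fin 2) (Fin 2) ℝ) : Prop :=
  ∀ σ : Matrix (Fin 2) (Fin 2) ℝ, IsQCM σ → GeqPMiDelta (K * σ * Kᵀ + α)

/-- The CP condition: both `α + i(Δ - KΔKᵀ)` and `α - i(Δ - KΔKᵀ)` are PSD. -/
noncomputable def CPCond (K α : Matrix (Fin 2) (Fin 2) ℝ) : Prop :=
  (α.map (Complex.ofReal) + Complex.I • ((Δ₂ - K * Δ₂ * Kᵀ).map (Complex.ofReal))).PosSemidef ∧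
  (α.map (Complex.ofReal) - Complex.I • ((Δ₂ - K * Δ₂ * Kᵀ).map (Complex.ofReal))).PosSemidef

/-- A Hermitian `2 × 2` matrix with nonnegative diagonal and determinant is PSD. -/
lemma posSemidef_fin_two {a c : ℝ} {z : ℂ} (ha : 0 ≤ a) (hc : 0 ≤ c)
    (h : z.re ^ 2 + z.im ^ 2 ≤ a * c) :
    (!![(a : ℂ), z; star z, (c : ℂ)]).PosSemidef := by
  refine Matrix.PosSemidef.of_dotProduct_mulVec_nonneg ?_ ?_
  · ext i j
    fin_cases i <;> fin_cases j <;> simp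
  · intro x
    rw [Complex.nonneg_iff]
    simp only [dotProduct, mulVec, Fin.sum_univ_two, Pi.star_apply, of_apply, cons_val', cons_val_zero,
      cons_val_one, cons_val_fin_one, RCLike.star_def]
    generalize x 0 = u
    generalize x 1 = v
    obtain ⟨u₁, u₂⟩ := u
    obtain ⟨v₁, v₂⟩ := v
    obtain ⟨b, e⟩ := z
    simp only [add_re, mul_re, conj_re, conj_im, ofReal_re, ofReal_im, add_im, mul_im] at h ⊢
    refine ⟨?_, by ring⟩
    rcases ha.eq_or_lt with rfl | ha
    · have hb : b = 0 := by nlinarith [sq_nonneg b, sq_nonneg e]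
      have he : e = 0 := by nlinarith [sq_nonneg b, sq_nonneg e]
      subst hb he
      nlinarith [mul_nonneg hc (sq_nonneg v₁), mul_nonneg hc (sq_nonneg v₂)]
    · refine nonneg_of_mul_nonneg_right (a := a) ?_ ha
      nlinarith [sq_nonneg (a * u₁ + b * v₁ - e * v₂), sq_nonneg (a * u₂ + b * v₂ + e * v₁),
        mul_nonneg (sub_nonneg.2 h) (add_nonneg (sq_nonneg v₁) (sq_nonneg v₂))]

lemma geqPMiDelta_iff (a b c : ℝ) :
    GeqPMiDelta !![a, b; b, c] ↔ 0 ≤ a ∧ 0 ≤ c ∧ 1 + b ^ 2 ≤ a * c := by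
  have hp : (!![a, b; b, c]).map Complex.ofReal + Complex.I • Δ₂.map Complex.ofReal =
      !![(a : ℂ), ⟨b, 1⟩; star ⟨b, 1⟩, (c : ℂ)] := by
    ext i j
    fin_cases i <;> fin_cases j <;> simp [Δ₂, Complex.ext_iff]
  have hm : (!![a, b; b, c]).map Complex.ofReal - Complex.I • Δ₂.map Complex.ofReal =
      !![(a : ℂ), ⟨b, -1⟩; star ⟨b, -1⟩, (c : ℂ)] := by
    ext i j
    fin_cases i <;> fin_cases j <;> simp [Δ₂, Complex.ext_iff]
  rw [GeqPMiDelta, hp, hm]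
  constructor
  · rintro ⟨h, -⟩
    have h0 := h.diag_nonneg (i := 0)
    have h1 := h.diag_nonneg (i := 1)
    have hd := (Complex.nonneg_iff.1 h.det_nonneg).1
    simp [det_fin_two] at h0 h1 hd
    exact ⟨h0, h1, by linarith⟩
  · rintro ⟨ha, hc, h⟩
    exact ⟨posSemidef_fin_two ha hc (by simp only; linarith),
      posSemidef_fin_two ha hc (by simp only; linarith)⟩

lemma exists_entries_of_isSymm {R : Type*} {σ : Matrix (Fin 2) (Fin 2) R} (h : σ.IsSymm) :
    ∃ a b c : R, σ = !![a, b; b, c] :=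
  ⟨σ 0 0, σ 0 1, σ 1 1, (Matrix.eta_fin_two σ).trans (by rw [h.apply 0 1])⟩

lemma congruence_add_eq (k l m n a b c p q r : ℝ) :
    !![k, l; m, n] * !![a, b; b, c] * (!![k, l; m, n])ᵀ + !![p, q; q, r] =
      !![k ^ 2 * a + 2 * k * l * b + l ^ 2 * c + p,
          k * m * a + (k * n + l * m) * b + l * n * c + q;
        k * m * a + (k * n + l * m) * b + l * n * c + q,
          m ^ 2 * a + 2 * m * n * b + n ^ 2 * c + r] := by
  ext i j
  fin_cases i <;> fin_cases j <;> simp [vecMul, dotProduct] <;> ring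

/-- The positivity condition in terms of matrix entries. -/
lemma posCond_iff (k l m n p q r : ℝ) :
    PosCond !![k, l; m, n] !![p, q; q, r] ↔
      ∀ a b c : ℝ, 0 ≤ a → 0 ≤ c → 1 + b ^ 2 ≤ a * c →
        0 ≤ k ^ 2 * a + 2 * k * l * b + l ^ 2 * c + p ∧
        0 ≤ m ^ 2 * a + 2 * m * n * b + n ^ 2 * c + r ∧
        1 + (k * m * a + (k * n + l * m) * b + l * n * c + q) ^ 2 ≤
          (k ^ 2 * a + 2 * k * l * b + l ^ 2 * c + p) *
            (m ^ 2 * a + 2 * m * n * b + n ^ 2 * c + r) := by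
  constructor
  · intro h a b c ha hc hb
    rw [← geqPMiDelta_iff, ← congruence_add_eq]
    refine h _ ⟨?_, (geqPMiDelta_iff a b c).2 ⟨ha, hc, hb⟩⟩
    ext i j
    fin_cases i <;> fin_cases j <;> rfl
  · rintro h σ ⟨hs, hσ⟩
    obtain ⟨a, b, c, rfl⟩ := exists_entries_of_isSymm hs
    obtain ⟨ha, hc, hb⟩ := (geqPMiDelta_iff a b c).1 hσ
    rw [congruence_add_eq, geqPMiDelta_iff]
    exact h a b c ha hc hb

lemma quadratic_form_nonneg {a b c : ℝ} (ha : 0 ≤ a) (hc : 0 ≤ c) (h : b ^ 2 ≤ a * c)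
    (x y : ℝ) : 0 ≤ x ^ 2 * a + 2 * x * y * b + y ^ 2 * c := by
  rcases ha.eq_or_lt with rfl | ha
  · have hb : b = 0 := by nlinarith [sq_nonneg b]
    subst hb
    nlinarith [mul_nonneg hc (sq_nonneg y)]
  · refine nonneg_of_mul_nonneg_right (a := a) ?_ ha
    nlinarith [sq_nonneg (a * x + b * y), mul_nonneg (sub_nonneg.2 h) (sq_nonneg y)]

/-- Minkowski's determinant inequality for PSD `2 × 2` matrices. -/
lemma minkowski_fin_two {a b c p q r x y : ℝ} (ha : 0 ≤ a) (hc : 0 ≤ c) (hp : 0 ≤ p)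
    (hr : 0 ≤ r) (hx : x ^ 2 = a * c - b ^ 2) (hy : y ^ 2 = p * r - q ^ 2) :
    (x + y) ^ 2 ≤ (a + p) * (c + r) - (b + q) ^ 2 := by
  have key : 2 * (x * y + b * q) ≤ a * r + c * p := by
    refine le_of_abs_le (abs_le_of_sq_le_sq ?_ (by positivity))
    have h1 : (x ^ 2 + b ^ 2) * (y ^ 2 + q ^ 2) = a * c * (p * r) := by rw [hx, hy]; ring
    nlinarith [sq_nonneg (x * q - b * y), sq_nonneg (a * r - c * p)]
  nlinarith

/-- If `K` is invertible and `β` is positive definite with `β ≥ α`, test the positivity condition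
on the covariance matrix `σ` with `K σ Kᵀ` proportional to `β`. -/
lemma one_le_of_test {k l m n p q r p' r' : ℝ} (hd : k * n - l * m ≠ 0)
    (hp : 0 ≤ p) (hr : 0 ≤ r) (hpp : p ≤ p') (hrr : r ≤ r') (hD : 0 < p' * r' - q ^ 2)
    (h : PosCond !![k, l; m, n] !![p, q; q, r]) :
    1 - |k * n - l * m| ≤ √(p' * r' - q ^ 2) := by
  rw [posCond_iff] at h
  set d := k * n - l * m with hd'
  set D := √(p' * r' - q ^ 2) with hD'
  have hD0 : 0 < D := Real.sqrt_pos.2 hD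
  have hD2 : D ^ 2 = p' * r' - q ^ 2 := Real.sq_sqrt hD.le
  set t := |d| / D with ht
  have ht0 : 0 ≤ t := by positivity
  have htD : t * D = |d| := div_mul_cancel₀ _ hD0.ne'
  have htD2 : t ^ 2 * (p' * r' - q ^ 2) = d ^ 2 := by rw [← hD2, ← mul_pow, htD, sq_abs]
  set s := t / d ^ 2 with hs
  have hsd : s * d ^ 2 = t := div_mul_cancel₀ _ (pow_ne_zero 2 hd)
  have hs0 : 0 ≤ s := by positivity
  have hq : q ^ 2 ≤ p' * r' := by linarith
  have hp' := hp.trans hpp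
  have hr' := hr.trans hrr
  obtain ⟨-, -, h3⟩ := h (s * (n ^ 2 * p' + 2 * n * (-l) * q + (-l) ^ 2 * r'))
    (s * (-n * m * p' + (n * k + l * m) * q - l * k * r'))
    (s * ((-m) ^ 2 * p' + 2 * (-m) * k * q + k ^ 2 * r'))
    (mul_nonneg hs0 (quadratic_form_nonneg hp' hr' hq _ _))
    (mul_nonneg hs0 (quadratic_form_nonneg hp' hr' hq _ _)) (by
      have e : s ^ 2 * d ^ 2 * (p' * r' - q ^ 2) = 1 := by
        have : (s ^ 2 * d ^ 2 * (p' * r' - q ^ 2)) * d ^ 2 = 1 * d ^ 2 := by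
          rw [← hsd] at htD2; linear_combination htD2
        exact mul_right_cancel₀ (pow_ne_zero 2 hd) this
      rw [hd'] at e
      apply le_of_eq
      linear_combination -e)
  have e1 : k ^ 2 * (s * (n ^ 2 * p' + 2 * n * (-l) * q + (-l) ^ 2 * r')) +
      2 * k * l * (s * (-n * m * p' + (n * k + l * m) * q - l * k * r')) +
      l ^ 2 * (s * ((-m) ^ 2 * p' + 2 * (-m) * k * q + k ^ 2 * r')) = t * p' := by
    rw [← hsd, hd']; ring
  have e2 : m ^ 2 * (s * (n ^ 2 * p' + 2 * n * (-l) * q + (-l) ^ 2 * r')) +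
      2 * m * n * (s * (-n * m * p' + (n * k + l * m) * q - l * k * r')) +
      n ^ 2 * (s * ((-m) ^ 2 * p' + 2 * (-m) * k * q + k ^ 2 * r')) = t * r' := by
    rw [← hsd, hd']; ring
  have e3 : k * m * (s * (n ^ 2 * p' + 2 * n * (-l) * q + (-l) ^ 2 * r')) +
      (k * n + l * m) * (s * (-n * m * p' + (n * k + l * m) * q - l * k * r')) +
      l * n * (s * ((-m) ^ 2 * p' + 2 * (-m) * k * q + k ^ 2 * r')) = t * q := by
    rw [← hsd, hd']; ring
  rw [e1, e2, e3] at h3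
  have h4 : (t * p' + p) * (t * r' + r) ≤ (t * p' + p') * (t * r' + r') := by gcongr
  have h5 : 1 ≤ (|d| + D) ^ 2 := by
    have : (|d| + D) ^ 2 = (1 + t) ^ 2 * D ^ 2 := by rw [← htD]; ring
    rw [this, hD2]
    linarith
  have h6 : 1 ≤ |d| + D := (one_le_sq_iff₀ (by positivity)).1 h5
  linarith

lemma sub_abs_det_le_of_posCond {k l m n p q r : ℝ} (hd : k * n - l * m ≠ 0)
    (hp : 0 ≤ p) (hr : 0 ≤ r) (hq : q ^ 2 ≤ p * r)
    (h : PosCond !![k, l; m, n] !![p, q; q, r]) :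
    1 - |k * n - l * m| ≤ √(p * r - q ^ 2) := by
  have hcont : Continuous fun ε : ℝ => √((p + ε) * (r + ε) - q ^ 2) := by fun_prop
  have hlim := (hcont.tendsto 0).mono_left (nhdsWithin_le_nhds (s := Set.Ioi 0))
  simp only [add_zero] at hlim
  refine ge_of_tendsto hlim ?_
  filter_upwards [self_mem_nhdsWithin] with ε hε
  have hε : 0 < ε := hε
  refine one_le_of_test hd hp hr (by linarith) (by linarith) ?_ h
  nlinarith [mul_pos hε hε, mul_nonneg hp hε.le, mul_nonneg hr hε.le]

/-- A singular `K` can squeeze `K σ Kᵀ` down to arbitrarily small multiples of `K Kᵀ`. -/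
lemma one_le_det_of_posCond {k l m n p q r : ℝ} (hd : k * n - l * m = 0)
    (h : PosCond !![k, l; m, n] !![p, q; q, r]) : 1 ≤ p * r - q ^ 2 := by
  obtain ⟨v, w, hvw, hv1, hv2⟩ : ∃ v w : ℝ, 0 < v ^ 2 + w ^ 2 ∧ k * v + l * w = 0 ∧
      m * v + n * w = 0 := by
    by_cases h1 : k = 0 ∧ l = 0
    · by_cases h2 : m = 0 ∧ n = 0
      · exact ⟨1, 0, by norm_num, by simp [h1], by simp [h2]⟩
      · refine ⟨n, -m, ?_, by linear_combination hd, by ring⟩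
        rw [← not_le]
        exact fun h => h2 ⟨by nlinarith [sq_nonneg n], by nlinarith [sq_nonneg m]⟩
    · refine ⟨-l, k, ?_, by ring, by linear_combination hd⟩
      rw [← not_le]
      exact fun h => h1 ⟨by nlinarith [sq_nonneg l], by nlinarith [sq_nonneg k]⟩
  rw [posCond_iff] at h
  have hcont : Continuous fun s : ℝ => (s * (k ^ 2 + l ^ 2) + p) * (s * (m ^ 2 + n ^ 2) + r) -
      (s * (k * m + l * n) + q) ^ 2 := by fun_prop
  have hlim := (hcont.tendsto 0).mono_left (nhdsWithin_le_nhds (s := Set.Ioi 0))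
  simp only [zero_mul, zero_add] at hlim
  refine ge_of_tendsto hlim ?_
  filter_upwards [self_mem_nhdsWithin] with s hs
  have hs : 0 < s := hs
  set g := (v ^ 2 + w ^ 2)⁻¹ with hg
  have hg1 : g * (v ^ 2 + w ^ 2) = 1 := inv_mul_cancel₀ hvw.ne'
  have hs1 : s⁻¹ * s = 1 := inv_mul_cancel₀ hs.ne'
  have hg0 : 0 < g := by positivity
  obtain ⟨-, -, h3⟩ := h (g * (s⁻¹ * v ^ 2 + s * w ^ 2)) (g * (s⁻¹ - s) * (v * w))
    (g * (s⁻¹ * w ^ 2 + s * v ^ 2)) (by positivity) (by positivity) (by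
      apply le_of_eq
      linear_combination (-(g * (v ^ 2 + w ^ 2)) - 1) * hg1 -
        g ^ 2 * (v ^ 2 + w ^ 2) ^ 2 * hs1)
  have e1 : k ^ 2 * (g * (s⁻¹ * v ^ 2 + s * w ^ 2)) + 2 * k * l * (g * (s⁻¹ - s) * (v * w)) +
      l ^ 2 * (g * (s⁻¹ * w ^ 2 + s * v ^ 2)) = s * (k ^ 2 + l ^ 2) := by
    linear_combination s * (k ^ 2 + l ^ 2) * hg1 + g * (s⁻¹ - s) * (k * v + l * w) * hv1
  have e2 : m ^ 2 * (g * (s⁻¹ * v ^ 2 + s * w ^ 2)) + 2 * m * n * (g * (s⁻¹ - s) * (v * w)) +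
      n ^ 2 * (g * (s⁻¹ * w ^ 2 + s * v ^ 2)) = s * (m ^ 2 + n ^ 2) := by
    linear_combination s * (m ^ 2 + n ^ 2) * hg1 + g * (s⁻¹ - s) * (m * v + n * w) * hv2
  have e3 : k * m * (g * (s⁻¹ * v ^ 2 + s * w ^ 2)) +
      (k * n + l * m) * (g * (s⁻¹ - s) * (v * w)) +
      l * n * (g * (s⁻¹ * w ^ 2 + s * v ^ 2)) = s * (k * m + l * n) := by
    linear_combination s * (k * m + l * n) * hg1 + g * (s⁻¹ - s) * (k * v + l * w) * hv2
  rw [e1, e2, e3] at h3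
  linarith

lemma posCond_of_sub_abs_det_le {k l m n p q r : ℝ} (hp : 0 ≤ p) (hr : 0 ≤ r)
    (hq : q ^ 2 ≤ p * r) (h : 1 - |k * n - l * m| ≤ √(p * r - q ^ 2)) :
    PosCond !![k, l; m, n] !![p, q; q, r] := by
  rw [posCond_iff]
  intro a b c ha hc hb
  have hA := quadratic_form_nonneg ha hc (by linarith : b ^ 2 ≤ a * c) k l
  have hC := quadratic_form_nonneg ha hc (by linarith : b ^ 2 ≤ a * c) m n
  refine ⟨by linarith, by linarith, ?_⟩
  have hS : 1 ≤ √(a * c - b ^ 2) := Real.one_le_sqrt.2 (by linarith)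
  have hM := minkowski_fin_two (b := k * m * a + (k * n + l * m) * b + l * n * c) (q := q)
    (x := |k * n - l * m| * √(a * c - b ^ 2)) (y := √(p * r - q ^ 2)) hA hC hp hr
    (by rw [mul_pow, sq_abs, Real.sq_sqrt (by linarith)]; ring)
    (Real.sq_sqrt (by linarith))
  have h1 : 1 ≤ |k * n - l * m| * √(a * c - b ^ 2) + √(p * r - q ^ 2) := by
    nlinarith [abs_nonneg (k * n - l * m)]
  have h2 := one_le_pow₀ (n := 2) h1
  linarith

/-- For one mode, `(K, α)` (with `α` real symmetric PSD) satisfies the positivity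
condition iff `√(det α) ≥ 1 - |det K|`. -/
theorem stmt5 (K α : Matrix (Fin 2) (Fin 2) ℝ) (hα : α.PosSemidef) :
    PosCond K α ↔ 1 - |K.det| ≤ Real.sqrt α.det := by
  obtain ⟨p, q, r, rfl⟩ := exists_entries_of_isSymm (σ := α) (by
    simpa [Matrix.IsHermitian, Matrix.IsSymm, Matrix.conjTranspose_eq_transpose_of_trivial]
      using hα.isHermitian)
  have hp := hα.diag_nonneg (i := 0)
  have hr := hα.diag_nonneg (i := 1)
  have hq := hα.det_nonneg
  have hdet : (!![p, q; q, r]).det = p * r - q ^ 2 := by rw [det_fin_two_of]; ring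
  simp only [of_apply, cons_val', cons_val_zero, cons_val_one, cons_val_fin_one] at hp hr
  rw [hdet] at hq ⊢
  have hq := sub_nonneg.1 hq
  rw [Matrix.eta_fin_two K, det_fin_two_of]
  refine ⟨fun h => ?_, posCond_of_sub_abs_det_le hp hr hq⟩
  by_cases hd : K 0 0 * K 1 1 - K 0 1 * K 1 0 = 0
  · rw [hd, abs_zero, sub_zero, Real.one_le_sqrt]
    exact one_le_det_of_posCond hd h
  · exact sub_abs_det_le_of_posCond hd hp hr hq h
end

section
/- Let n = 1, so all matrices are 2×2. Let K be a real 2×2 matrix and α a real symmetric positive semidefinite 2×2 matrix. Then the pair (K,α) satisfies the CP condition (i.e. both α + i(Δ − KΔKᵀ) and α − i(Δ − KΔKᵀ) are positive semidefinite) if and only if √(det α) ≥ |1 − det K|. -/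
open Matrix Complex
open scoped ComplexOrder

theorem Matrix.IsHermitian.posSemidef_fin_two_of_trace_of_det {𝕜 : Type*} [RCLike 𝕜]
    {M : Matrix (Fin 2) (Fin 2) 𝕜} (hM : M.IsHermitian) (htr : 0 ≤ M.trace) (hdet : 0 ≤ M.det) :
    M.PosSemidef := by
  rw [hM.posSemidef_iff_eigenvalues_nonneg]
  rw [hM.trace_eq_sum_eigenvalues, Fin.sum_univ_two, ← RCLike.ofReal_add,
    RCLike.ofReal_nonneg] at htr
  rw [hM.det_eq_prod_eigenvalues, Fin.prod_univ_two, ← RCLike.ofReal_mul,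
    RCLike.ofReal_nonneg] at hdet
  intro i
  fin_cases i <;> simp only [Pi.zero_apply, Fin.zero_eta, Fin.mk_one] <;> nlinarith

theorem mul_Δ₂_mul_transpose (K : Matrix (Fin 2) (Fin 2) ℝ) : K * Δ₂ * Kᵀ = K.det • Δ₂ := by
  ext i j
  fin_cases i <;> fin_cases j <;>
    simp [Δ₂, Matrix.mul_apply, Fin.sum_univ_two, Matrix.det_fin_two] <;> ring

/-- A real positive semidefinite `2 × 2` matrix perturbed by `i d Δ` stays positive semidefinite
exactly when `d ^ 2` is at most its determinant. -/
theorem posSemidef_add_I_smul_Δ₂_iff {α : Matrix (Fin 2) (Fin 2) ℝ} (hα : α.PosSemidef) (d : ℝ) :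
    (α.map Complex.ofReal + Complex.I • (d • Δ₂).map Complex.ofReal).PosSemidef ↔
      d ^ 2 ≤ α.det := by
  have hsymm : α 1 0 = α 0 1 := by simpa using hα.isHermitian.apply 0 1
  have hdet : (α.map Complex.ofReal + Complex.I • (d • Δ₂).map Complex.ofReal).det =
      ((α.det - d ^ 2 : ℝ) : ℂ) := by
    simp only [Δ₂, Matrix.det_fin_two, Matrix.add_apply, Matrix.smul_apply, Matrix.map_apply]
    simp [hsymm]
    linear_combination (d : ℂ) ^ 2 * Complex.I_sq
  constructor
  · intro h
    have := h.det_nonneg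
    rw [hdet, Complex.zero_le_real] at this
    linarith
  · intro h
    refine Matrix.IsHermitian.posSemidef_fin_two_of_trace_of_det ?_ ?_ ?_
    · ext i j
      fin_cases i <;> fin_cases j <;> simp [Δ₂, hsymm]
    · have htr : (α.map Complex.ofReal + Complex.I • (d • Δ₂).map Complex.ofReal).trace =
          ((α.trace : ℝ) : ℂ) := by
        simp [Matrix.trace_fin_two, Δ₂]
      rw [htr, Complex.zero_le_real]
      exact hα.trace_nonneg
    · rw [hdet, Complex.zero_le_real]
      linarith

/-- For one mode, `(K, α)` (with `α` real symmetric PSD) satisfies the CP condition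
iff `√(det α) ≥ |1 - det K|`. -/
theorem stmt6 (K α : Matrix (Fin 2) (Fin 2) ℝ) (hα : α.PosSemidef) :
    CPCond K α ↔ |1 - K.det| ≤ Real.sqrt α.det := by
  have hd : Δ₂ - K * Δ₂ * Kᵀ = (1 - K.det) • Δ₂ := by
    rw [mul_Δ₂_mul_transpose, sub_smul, one_smul]
  have hneg : α.map Complex.ofReal - Complex.I • ((1 - K.det) • Δ₂).map Complex.ofReal =
      α.map Complex.ofReal + Complex.I • ((-(1 - K.det)) • Δ₂).map Complex.ofReal := by
    ext i j
    simp [sub_eq_add_neg]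
    ring
  rw [CPCond, hd, hneg, posSemidef_add_I_smul_Δ₂_iff hα, posSemidef_add_I_smul_Δ₂_iff hα,
    neg_sq, and_self, Real.le_sqrt (abs_nonneg _) hα.det_nonneg, sq_abs]
end

section
/- Let n = 1, so all matrices are 2×2. Let K be a real 2×2 matrix and α a real symmetric positive semidefinite 2×2 matrix such that the pair (K,α) satisfies the positivity condition. Then there exist a real number λ ≥ 1 and a real 2×2 matrix K' such that either K = λ·K' or K = λ·K'·T, and the pair (K',α) satisfies the CP condition. (In other words, every one-mode Gaussian-to-Gaussian map is a phase-space dilatation by λ ≥ 1, possibly composed with the transposition, followed by a completely positive Gaussian map.) -/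
open Matrix Complex
open scoped ComplexOrder

/-- A real positive semidefinite `2 × 2` matrix perturbed by `i c Δ` stays positive semidefinite
as soon as its determinant is at least `c ^ 2`. -/
theorem posSemidef_add_I_smul {σ S : Matrix (Fin 2) (Fin 2) ℝ} (hσ : σ.PosSemidef) (c : ℝ)
    (hS : S = c • Δ₂) (hc : c ^ 2 ≤ σ.det) :
    (σ.map Complex.ofReal + Complex.I • S.map Complex.ofReal).PosSemidef := by
  subst hS
  have hsymm : σ 1 0 = σ 0 1 := by simpa using hσ.isHermitian.apply 0 1
  have ha : 0 ≤ σ 0 0 := hσ.diag_nonneg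
  have hd : 0 ≤ σ 1 1 := hσ.diag_nonneg
  rw [Matrix.det_fin_two, hsymm] at hc
  refine Matrix.PosSemidef.of_dotProduct_mulVec_nonneg ?_ fun x => ?_
  · ext i j
    fin_cases i <;> fin_cases j <;> simp [Δ₂, hsymm]
  · rw [Complex.nonneg_iff]
    simp only [dotProduct, mulVec, Fin.sum_univ_two, Δ₂]
    simp [hsymm]
    constructor
    · generalize (x 0).re = x₁, (x 0).im = x₂, (x 1).re = y₁, (x 1).im = y₂
      generalize σ 0 0 = a, σ 0 1 = b, σ 1 1 = d at *
      rcases ha.eq_or_lt with rfl | ha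
      · have hb : b = 0 := by nlinarith [sq_nonneg b, sq_nonneg c]
        have hc0 : c = 0 := by nlinarith [sq_nonneg b, sq_nonneg c]
        subst hb hc0
        nlinarith [mul_nonneg hd (sq_nonneg y₁), mul_nonneg hd (sq_nonneg y₂)]
      · refine nonneg_of_mul_nonneg_right ?_ ha
        have hc' : 0 ≤ a * d - b * b - c ^ 2 := by linarith
        nlinarith [mul_nonneg hc' (sq_nonneg y₁), mul_nonneg hc' (sq_nonneg y₂),
          sq_nonneg (a * x₁ + b * y₁ - c * y₂), sq_nonneg (a * x₂ + b * y₂ + c * y₁)]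
    · ring

theorem geqPMiDelta_of_one_le_det {σ : Matrix (Fin 2) (Fin 2) ℝ} (hσ : σ.PosSemidef)
    (h : 1 ≤ σ.det) : GeqPMiDelta σ := by
  refine ⟨posSemidef_add_I_smul hσ 1 (by simp) (by simpa using h), ?_⟩
  have := posSemidef_add_I_smul (S := -Δ₂) hσ (-1) (by simp) (by simpa using h)
  convert this using 1
  ext i j
  simp [sub_eq_add_neg]

theorem isQCM_of_one_le_det {σ : Matrix (Fin 2) (Fin 2) ℝ} (hσ : σ.PosSemidef)
    (h : 1 ≤ σ.det) : IsQCM σ :=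
  ⟨by simpa [Matrix.IsHermitian, Matrix.IsSymm] using hσ.isHermitian,
    geqPMiDelta_of_one_le_det hσ h⟩

theorem GeqPMiDelta.one_le_det {σ : Matrix (Fin 2) (Fin 2) ℝ} (h : GeqPMiDelta σ)
    (hσ : σ.IsSymm) : 1 ≤ σ.det := by
  have hdet := h.1.det_nonneg
  have hsymm : σ 1 0 = σ 0 1 := hσ.apply 0 1
  rw [Complex.nonneg_iff, Matrix.det_fin_two] at hdet
  have := hdet.1
  simp [Δ₂, hsymm] at this
  rw [Matrix.det_fin_two, hsymm]
  linarith

theorem PosCond.one_le_det {K α σ : Matrix (Fin 2) (Fin 2) ℝ} (h : PosCond K α)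
    (hα : α.PosSemidef) (hσ : σ.PosSemidef) (hdet : 1 ≤ σ.det) :
    1 ≤ (K * σ * Kᵀ + α).det := by
  refine (h σ (isQCM_of_one_le_det hσ hdet)).one_le_det ?_
  have := ((hσ.mul_mul_conjTranspose_same K).add hα).isHermitian
  simpa [Matrix.IsHermitian, Matrix.IsSymm] using this

theorem cpCond_of_sq_le_det {K α : Matrix (Fin 2) (Fin 2) ℝ} (hα : α.PosSemidef)
    (h : (1 - K.det) ^ 2 ≤ α.det) : CPCond K α := by
  have hK : Δ₂ - K * Δ₂ * Kᵀ = (1 - K.det) • Δ₂ := by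
    ext i j
    fin_cases i <;> fin_cases j <;>
      simp [Δ₂, Matrix.mul_apply, Matrix.det_fin_two, Fin.sum_univ_two] <;> ring
  refine ⟨posSemidef_add_I_smul hα _ hK h, ?_⟩
  have := posSemidef_add_I_smul (S := -(Δ₂ - K * Δ₂ * Kᵀ)) hα (-(1 - K.det))
    (by rw [hK, neg_smul]) (by rwa [neg_sq])
  convert this using 1
  ext i j
  simp only [Matrix.sub_apply, Matrix.add_apply, Matrix.smul_apply, Matrix.map_apply,
    Matrix.neg_apply, Complex.ofReal_neg, smul_neg, sub_eq_add_neg]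

/-- A polynomial lower bound valid for all positive arguments holds at `0`. -/
theorem le_of_forall_pos_le_quadratic {m p q r : ℝ}
    (h : ∀ ε : ℝ, 0 < ε → m ≤ p + ε * q + ε ^ 2 * r) : m ≤ p := by
  have hcont : Continuous fun ε : ℝ => p + ε * q + ε ^ 2 * r := by fun_prop
  have ht : Filter.Tendsto (fun ε : ℝ => p + ε * q + ε ^ 2 * r)
      (nhdsWithin 0 (Set.Ioi 0)) (nhds p) := by
    simpa using (hcont.tendsto 0).mono_left nhdsWithin_le_nhds
  exact ge_of_tendsto ht (Filter.eventually_of_mem self_mem_nhdsWithin h)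

theorem PosCond.one_le_det_of_det_eq_zero {K α : Matrix (Fin 2) (Fin 2) ℝ}
    (h : PosCond K α) (hα : α.PosSemidef) (hK : K.det = 0) : 1 ≤ α.det := by
  by_cases hK0 : K = 0
  · simpa [hK0] using h.one_le_det hα Matrix.PosSemidef.one (by simp)
  set f : ℝ := K 0 0 ^ 2 + K 0 1 ^ 2 + K 1 0 ^ 2 + K 1 1 ^ 2 with hf
  have hfpos : 0 < f := by
    refine lt_of_le_of_ne (by positivity) fun h0 => hK0 ?_
    ext i j
    fin_cases i <;> fin_cases j <;> simp <;>
      nlinarith [sq_nonneg (K 0 0), sq_nonneg (K 0 1), sq_nonneg (K 1 0), sq_nonneg (K 1 1)]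
  refine le_of_forall_pos_le_quadratic (q := α 0 0 * (K * Kᵀ) 1 1 + α 1 1 * (K * Kᵀ) 0 0
    - α 0 1 * (K * Kᵀ) 1 0 - α 1 0 * (K * Kᵀ) 0 1) (r := (K * Kᵀ).det) fun ε hε => ?_
  set N := K.adjugate with hN
  have hσ : (ε • (1 : Matrix (Fin 2) (Fin 2) ℝ) + (ε * f)⁻¹ • (N * Nᵀ)).PosSemidef := by
    refine (Matrix.PosSemidef.one.smul hε.le).add (Matrix.PosSemidef.smul ?_ (by positivity))
    simpa using Matrix.posSemidef_self_mul_conjTranspose N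
  have hdet : 1 ≤ (ε • (1 : Matrix (Fin 2) (Fin 2) ℝ) + (ε * f)⁻¹ • (N * Nᵀ)).det := by
    have : (ε • (1 : Matrix (Fin 2) (Fin 2) ℝ) + (ε * f)⁻¹ • (N * Nᵀ)).det
        = ε ^ 2 + ε * (ε * f)⁻¹ * f + ((ε * f)⁻¹) ^ 2 * K.det ^ 2 := by
      have hadj : N = !![K 1 1, -K 0 1; -K 1 0, K 0 0] := Matrix.adjugate_fin_two K
      simp only [hadj, Matrix.det_fin_two, hf, Matrix.add_apply, Matrix.smul_apply,
        Matrix.mul_apply, Fin.sum_univ_two, Matrix.transpose_apply]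
      simp
      ring
    rw [this, hK, show ε * (ε * f)⁻¹ * f = 1 by field_simp]
    nlinarith [sq_nonneg ε]
  have hmain := h.one_le_det hα hσ hdet
  have hKσ : K * (ε • (1 : Matrix (Fin 2) (Fin 2) ℝ) + (ε * f)⁻¹ • (N * Nᵀ)) * Kᵀ
      = ε • (K * Kᵀ) := by
    have hKN : K * N = 0 := by rw [hN, Matrix.mul_adjugate, hK, zero_smul]
    rw [Matrix.mul_add, Matrix.mul_smul, Matrix.mul_smul, ← Matrix.mul_assoc K N, hKN]
    simp
  rw [hKσ] at hmain
  refine hmain.trans_eq ?_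
  simp only [Matrix.det_fin_two, Matrix.add_apply, Matrix.smul_apply, smul_eq_mul]
  ring

theorem PosCond.sq_le_det_of_det_ne_zero {K α : Matrix (Fin 2) (Fin 2) ℝ}
    (h : PosCond K α) (hα : α.PosSemidef) (hK : K.det ≠ 0) (hK1 : |K.det| ≤ 1) :
    (1 - |K.det|) ^ 2 ≤ α.det := by
  refine le_of_forall_pos_le_quadratic (q := α 0 0 + α 1 1) (r := 1) fun ε hε => ?_
  have hk : 0 < |K.det| := abs_pos.mpr hK
  have ha : 0 ≤ α 0 0 := hα.diag_nonneg
  have hd : 0 ≤ α 1 1 := hα.diag_nonneg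
  have hαdet : 0 ≤ α.det := hα.det_nonneg
  set k := |K.det| with hkdef
  set N := K.adjugate with hN
  set β := α + ε • (1 : Matrix (Fin 2) (Fin 2) ℝ) with hβ
  have hβpsd : β.PosSemidef := hα.add (Matrix.PosSemidef.one.smul hε.le)
  have hβdet : β.det = α.det + ε * (α 0 0 + α 1 1) + ε ^ 2 * 1 := by
    simp [hβ, Matrix.det_fin_two]
    ring
  have hβpos : 0 < β.det := by rw [hβdet]; positivity
  obtain ⟨s, hs, hs2⟩ : ∃ s : ℝ, 0 < s ∧ s ^ 2 = β.det :=
    ⟨√β.det, Real.sqrt_pos.mpr hβpos, Real.sq_sqrt hβpos.le⟩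
  have hσ : ((k * s)⁻¹ • (N * β * Nᵀ)).PosSemidef := by
    refine Matrix.PosSemidef.smul ?_ (by positivity)
    simpa using hβpsd.mul_mul_conjTranspose_same N
  have hkk : K.det ^ 2 = k ^ 2 := (sq_abs _).symm
  have hdet : ((k * s)⁻¹ • (N * β * Nᵀ)).det = 1 := by
    have hNdet : N.det = K.det := by simp [hN, Matrix.det_adjugate]
    rw [Matrix.det_smul, Matrix.det_mul, Matrix.det_mul, Matrix.det_transpose, hNdet, ← hs2,
      Fintype.card_fin, show K.det * s ^ 2 * K.det = K.det ^ 2 * s ^ 2 by ring, hkk]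
    field_simp
  have hmain := h.one_le_det hα hσ hdet.ge
  have hKσ : K * ((k * s)⁻¹ • (N * β * Nᵀ)) * Kᵀ = (k / s) • β := by
    have hKN : K * N = K.det • 1 := Matrix.mul_adjugate K
    have hNK : Nᵀ * Kᵀ = K.det • 1 := by
      rw [← Matrix.transpose_mul, hKN, Matrix.transpose_smul, Matrix.transpose_one]
    have : K * (N * β * Nᵀ) * Kᵀ = (K * N) * β * (Nᵀ * Kᵀ) := by
      simp only [Matrix.mul_assoc]
    rw [Matrix.mul_smul, Matrix.smul_mul, this, hKN, hNK]
    simp only [Matrix.smul_mul, Matrix.mul_smul, Matrix.one_mul, Matrix.mul_one, smul_smul]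
    congr 1
    rw [← sq, hkk]
    field_simp
  have hle : (K * ((k * s)⁻¹ • (N * β * Nᵀ)) * Kᵀ + α).det ≤ (k + s) ^ 2 := by
    have hexp : ((k / s) • β + α).det = (k / s) ^ 2 * β.det
        + (k / s) * (2 * β.det - ε * (α 0 0 + α 1 1) - 2 * ε ^ 2) + α.det := by
      rw [hβdet]
      simp [hβ, Matrix.det_fin_two]
      ring
    have hks : 0 < k / s := by positivity
    have h1 : (k / s) * (2 * β.det - ε * (α 0 0 + α 1 1) - 2 * ε ^ 2)
        ≤ (k / s) * (2 * β.det) := by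
      refine mul_le_mul_of_nonneg_left ?_ hks.le
      nlinarith [mul_nonneg hε.le (add_nonneg ha hd), sq_nonneg ε]
    have h2 : α.det ≤ β.det := by
      rw [hβdet]
      nlinarith [mul_nonneg hε.le (add_nonneg ha hd), sq_nonneg ε]
    rw [hKσ, hexp]
    calc _ ≤ (k / s) ^ 2 * β.det + (k / s) * (2 * β.det) + β.det := by linarith
      _ = (k + s) ^ 2 := by rw [← hs2]; field_simp; ring
  rw [← hβdet, ← hs2]
  have : 1 ≤ k + s := by
    by_contra! hlt
    nlinarith [hmain.trans hle]
  exact pow_le_pow_left₀ (by linarith) (by linarith) 2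

/-- A matrix is a dilatation of one with determinant `|det K| / l ^ 2`, up to transposition. -/
theorem exists_dilatation_det_eq (K : Matrix (Fin 2) (Fin 2) ℝ) {l : ℝ} (hl : l ≠ 0) :
    ∃ K' : Matrix (Fin 2) (Fin 2) ℝ,
      (K = l • K' ∨ K = l • (K' * T₂)) ∧ K'.det = |K.det| / l ^ 2 := by
  have hT : T₂ * T₂ = 1 := by
    ext i j
    fin_cases i <;> fin_cases j <;> simp [T₂, Matrix.mul_apply]
  have hTdet : T₂.det = -1 := by simp [T₂, Matrix.det_fin_two]
  rcases le_total 0 K.det with h | h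
  · refine ⟨l⁻¹ • K, Or.inl (by rw [smul_inv_smul₀ hl]), ?_⟩
    rw [Matrix.det_smul, Fintype.card_fin, abs_of_nonneg h]
    field_simp
  · refine ⟨l⁻¹ • (K * T₂), Or.inr ?_, ?_⟩
    · rw [Matrix.smul_mul, smul_inv_smul₀ hl, Matrix.mul_assoc, hT, Matrix.mul_one]
    · rw [Matrix.det_smul, Matrix.det_mul, hTdet, Fintype.card_fin, abs_of_nonpos h]
      field_simp

/-- Every one-mode Gaussian-to-Gaussian map is a dilatation by `λ ≥ 1`, possibly
composed with the transposition, followed by a completely positive Gaussian map. -/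
theorem stmt7 (K α : Matrix (Fin 2) (Fin 2) ℝ) (hα : α.PosSemidef)
    (h : PosCond K α) :
    ∃ l : ℝ, 1 ≤ l ∧ ∃ K' : Matrix (Fin 2) (Fin 2) ℝ,
      (K = l • K' ∨ K = l • (K' * T₂)) ∧ CPCond K' α := by
  rcases le_total 1 |K.det| with hk | hk
  · have hsq : √|K.det| ^ 2 = |K.det| := Real.sq_sqrt (abs_nonneg _)
    have hl : 1 ≤ √|K.det| := Real.one_le_sqrt.mpr hk
    obtain ⟨K', hK', hdet⟩ := exists_dilatation_det_eq K (l := √|K.det|) (by positivity)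
    refine ⟨_, hl, K', hK', cpCond_of_sq_le_det hα ?_⟩
    rw [hdet, hsq, div_self (by positivity)]
    simpa using hα.det_nonneg
  · obtain ⟨K', hK', hdet⟩ := exists_dilatation_det_eq K one_ne_zero
    refine ⟨1, le_rfl, K', hK', cpCond_of_sq_le_det hα ?_⟩
    rw [hdet, one_pow, div_one]
    by_cases hK : K.det = 0
    · simpa [hK] using h.one_le_det_of_det_eq_zero hα hK
    · exact h.sq_le_det_of_det_ne_zero hα hK hk
end
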